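/- Let g : (ℂⁿ, 0) → (ℂⁿ, 0) be a germ of a finite holomorphic map and let X be a germ of an analytic hypersurface at 0 that is reducible at 0 (i.e., has at least two distinct irreducible components through 0). Then g⁻¹(X) is a germ of a reducible hypersurface at 0, and in particular g⁻¹(X) is singular at 0. -/

import Mathlib

open Set Filter Topology

noncomputable section

/-- `ℂⁿ`, modeled as the space of functions `Fin n → ℂ`. -/
abbrev Cn (n : ℕ) : Type := Fin n → ℂ

/-- `X` is an analytic hypersurface in the open set `W`, with its reduced structure:
near every point of `W` it is the zero set of a holomorphic function that does not
vanish identically on a connected neighborhood (hence every irreducible component of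
`X` has codimension one). -/
def IsHypersurfaceIn {n : ℕ} (W X : Set (Cn n)) : Prop :=
  X ⊆ W ∧ ∀ p ∈ W, ∃ V : Set (Cn n), IsOpen V ∧ IsPreconnected V ∧ p ∈ V ∧ V ⊆ W ∧
    ∃ ψ : Cn n → ℂ, AnalyticOnNhd ℂ ψ V ∧ (∃ x ∈ V, ψ x ≠ 0) ∧ X ∩ V = {x ∈ V | ψ x = 0}

/-- A hypersurface `X` is smooth at `p` if near `p` it is a codimension-one complex
submanifold of `ℂⁿ`, i.e. the zero set of a holomorphic function submersive at `p`.
"`X` is singular at `p`" is the negation of this. -/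
def SmoothPointAt {n : ℕ} (X : Set (Cn n)) (p : Cn n) : Prop :=
  ∃ (V : Set (Cn n)) (φ : Cn n → ℂ), IsOpen V ∧ p ∈ V ∧ AnalyticOnNhd ℂ φ V ∧
    fderiv ℂ φ p ≠ 0 ∧ X ∩ V = {x ∈ V | φ x = 0}

/-- The germ of the hypersurface `X` at `p` is reducible: on some neighborhood of `p`,
`X` is the union of two hypersurfaces through `p`, neither of which is contained in the
other on any neighborhood of `p` (so `X` has at least two distinct irreducible
components through `p`). -/
def GermReducibleAt {n : ℕ} (X : Set (Cn n)) (p : Cn n) : Prop :=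
  ∃ (V X₁ X₂ : Set (Cn n)), IsOpen V ∧ p ∈ V ∧
    IsHypersurfaceIn V X₁ ∧ IsHypersurfaceIn V X₂ ∧ p ∈ X₁ ∧ p ∈ X₂ ∧
    X ∩ V = X₁ ∪ X₂ ∧
    (¬ ∃ V' : Set (Cn n), IsOpen V' ∧ p ∈ V' ∧ X₁ ∩ V' ⊆ X₂) ∧
    (¬ ∃ V' : Set (Cn n), IsOpen V' ∧ p ∈ V' ∧ X₂ ∩ V' ⊆ X₁)

/-- The determinant as a continuous multilinear function of the rows. -/
def detRowCM (n : ℕ) : ContinuousMultilinearMap ℂ (fun _ : Fin n => Cn n) ℂ where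
  toMultilinearMap := (Matrix.detRowAlternating (n := Fin n) (R := ℂ)).toMultilinearMap
  cont := Continuous.matrix_det (A := fun M : Fin n → Cn n => Matrix.of M) continuous_id

lemma detRowCM_apply {n : ℕ} (M : Fin n → Cn n) : detRowCM n M = (Matrix.of M).det := rfl

/-- The partial derivatives of `g` at `x`. -/
def partials {n : ℕ} (g : Cn n → Cn n) (x : Cn n) : Fin n → Cn n :=
  fun k => fderiv ℂ g x (Pi.single k 1)

/-- The complex Jacobian determinant of `g`. -/
def jac {n : ℕ} (g : Cn n → Cn n) (x : Cn n) : ℂ := detRowCM n (partials g x)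

/-- The adjugate of the derivative of `g` applied to the constant vector `v`. -/
def adjField {n : ℕ} (g : Cn n → Cn n) (v : Cn n) (x : Cn n) : Cn n :=
  fun j => detRowCM n (Function.update (partials g x) j v)

lemma analyticAt_partials {n : ℕ} {g : Cn n → Cn n} {x : Cn n} (hg : AnalyticAt ℂ g x) :
    AnalyticAt ℂ (partials g) x :=
  AnalyticAt.pi fun k =>
    ((ContinuousLinearMap.apply ℂ (Cn n) (Pi.single k (1 : ℂ) : Cn n)).analyticAt _).comp
      (f := fderiv ℂ g) hg.fderiv

lemma analyticAt_jac {n : ℕ} {g : Cn n → Cn n} {x : Cn n} (hg : AnalyticAt ℂ g x) :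
    AnalyticAt ℂ (jac g) x :=
  (detRowCM n).analyticAt.comp (analyticAt_partials hg)

lemma analyticAt_adjField {n : ℕ} {g : Cn n → Cn n} {x : Cn n} (v : Cn n)
    (hg : AnalyticAt ℂ g x) : AnalyticAt ℂ (adjField g v) x := by
  refine AnalyticAt.pi fun j => ?_
  refine (detRowCM n).analyticAt.comp
    (f := fun y => Function.update (partials g y) j v) (AnalyticAt.pi fun k => ?_)
  by_cases hk : k = j
  · subst hk
    simpa using analyticAt_const
  · simpa [hk] using (analyticAt_pi_iff.1 (analyticAt_partials hg)) k

lemma fderiv_adjField {n : ℕ} (g : Cn n → Cn n) (v x : Cn n) :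
    fderiv ℂ g x (adjField g v x) = jac g x • v := by
  have h := Matrix.mulVec_cramer (Matrix.of (partials g x)).transpose v
  have h1 : (Matrix.of (partials g x)).transpose.cramer v = adjField g v x := by
    ext j
    rw [Matrix.cramer_transpose_apply]
    rfl
  rw [h1, Matrix.det_transpose] at h
  change _ = jac g x • v at h
  rw [← h, Matrix.mulVec_eq_sum]
  conv_lhs => rw [pi_eq_sum_univ' (adjField g v x)]
  rw [map_sum]
  refine Finset.sum_congr rfl fun k _ => ?_
  simp
  rfl

/-- The Piola identity. -/
lemma sum_fderiv_adjField_eq_zero {n : ℕ} {g : Cn n → Cn n} (v : Cn n) {x : Cn n}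
    (hg : AnalyticAt ℂ g x) :
    ∑ j, fderiv ℂ (adjField g v) x (Pi.single j 1) j = 0 := by
  set H : Fin n → Fin n → Cn n := fun j k =>
    fderiv ℂ (fderiv ℂ g) x (Pi.single j 1) (Pi.single k 1)
    with hH
  have hsymm : ∀ j k, H j k = H k j := fun j k =>
    (hg.contDiffAt (n := ⊤)).isSymmSndFDerivAt_of_omega.eq _ _
  have key : ∀ j, fderiv ℂ (adjField g v) x (Pi.single j 1) j =
      ∑ k, if k = j then 0 else
        detRowCM n (Function.update (Function.update (partials g x) j v) k (H j k)) := by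
    intro j
    have hp : ∀ k, HasFDerivAt (fun y => Function.update (partials g y) j v k)
        (if k = j then 0 else (fderiv ℂ (fderiv ℂ g) x).flip (Pi.single k 1)) x := by
      intro k
      by_cases hk : k = j
      · subst hk
        simpa using hasFDerivAt_const (𝕜 := ℂ) v x
      · simp only [Function.update_of_ne hk, hk, if_false]
        exact (ContinuousLinearMap.apply ℂ (Cn n) (Pi.single k (1 : ℂ) : Cn n)).hasFDerivAt.comp x
          hg.fderiv.differentiableAt.hasFDerivAt
    have := HasFDerivAt.multilinear_comp (f := detRowCM n) hp
    have h2 := (hasFDerivAt_pi'.1 (analyticAt_adjField v hg).differentiableAt.hasFDerivAt) j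
    have h3 := h2.unique this
    have h4 := congrArg (fun L => L (Pi.single j 1)) h3
    simp at h4
    rw [h4]
    refine Finset.sum_congr rfl fun k _ => ?_
    by_cases hk : k = j
    · subst hk
      simp only [if_true, zero_apply, Function.update_idem]
      exact (detRowCM n).toMultilinearMap.map_update_zero (partials g x) k
    · simp [hk, hH]
  simp_rw [key]
  have anti : ∀ j k, j ≠ k →
      detRowCM n (Function.update (Function.update (partials g x) j v) k (H j k)) =
      -detRowCM n (Function.update (Function.update (partials g x) k v) j (H k j)) := by
    intro j k hjk
    have := (Matrix.detRowAlternating (n := Fin n) (R := ℂ)).map_swap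
      (Function.update (Function.update (partials g x) k v) j (H k j)) hjk
    change _ = -detRowCM n (Function.update (Function.update (partials g x) k v) j (H k j)) at this
    rw [← this]
    change _ = detRowCM n _
    congr 1
    ext i : 1
    simp only [Function.comp]
    by_cases h1 : i = j
    · subst h1
      simp [hjk, hjk.symm]
    · by_cases h2 : i = k
      · subst h2
        simp [hsymm]
      · simp [h1, h2, Equiv.swap_apply_of_ne_of_ne]
  set T := ∑ j, ∑ k, (if k = j then 0 else
        detRowCM n (Function.update (Function.update (partials g x) j v) k (H j k))) with hT
  have : T = -T := by
    conv_lhs => rw [hT, Finset.sum_comm]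
    rw [hT, ← Finset.sum_neg_distrib]
    refine Finset.sum_congr rfl fun j _ => ?_
    rw [← Finset.sum_neg_distrib]
    refine Finset.sum_congr rfl fun k _ => ?_
    by_cases hk : k = j
    · simp [hk]
    · simp [hk, Ne.symm hk, anti k j hk]
  exact self_eq_neg.1 this

section

open MeasureTheory

/-- The real divergence at a point of a vector field on `ℂⁿ` with real derivative `A` there. -/
def realDiv {n : ℕ} (A : Cn n →L[ℝ] Cn n) : ℝ :=
  ∑ j, ((A (Pi.single j 1) j).re + (A (Pi.single j Complex.I) j).im)

lemma realDiv_zero {n : ℕ} : realDiv (0 : Cn n →L[ℝ] Cn n) = 0 := by simp [realDiv]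

lemma integrable_and_integral_clm_fderiv {n : ℕ} {T : Cn n → Cn n} (hT : ContDiff ℝ 1 T)
    (hc : HasCompactSupport T) (L : Cn n →L[ℝ] ℝ) (u : Cn n) :
    Integrable (fun x => L (fderiv ℝ T x u)) ∧ ∫ x, L (fderiv ℝ T x u) = 0 := by
  have hfd : ∀ x, fderiv ℝ (fun x => L (T x)) x u = L (fderiv ℝ T x u) := fun x => by
    have := (L.hasFDerivAt.comp x (hT.differentiable one_ne_zero x).hasFDerivAt).fderiv
    change fderiv ℝ (L ∘ T) x u = _
    rw [this]; rfl
  have hcont : Continuous fun x => L (fderiv ℝ T x u) :=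
    L.continuous.comp ((hT.continuous_fderiv one_ne_zero).clm_apply continuous_const)
  have hLdT : Integrable (fun x => L (fderiv ℝ T x u)) := by
    refine hcont.integrable_of_hasCompactSupport ?_
    exact (hc.fderiv (𝕜 := ℝ)).comp_left (g := fun A : Cn n →L[ℝ] Cn n => L (A u)) (by simp)
  refine ⟨hLdT, ?_⟩
  have hLT : Integrable (fun x => L (T x)) :=
    (L.continuous.comp hT.continuous).integrable_of_hasCompactSupport
      (hc.comp_left (g := L) (by simp))
  have := integral_mul_fderiv_eq_neg_fderiv_mul_of_integrable (μ := volume) (f := fun _ => (1 : ℝ))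
    (g := fun x => L (T x)) (v := u) (by simp) (by simpa [hfd] using hLdT)
    (by simpa using hLT) (fun _ _ => differentiableAt_const _)
    (fun x _ => (L.differentiableAt.comp x (hT.differentiable one_ne_zero x)))
  simpa [hfd] using this

lemma integral_realDiv_eq_zero {n : ℕ} {T : Cn n → Cn n} (hT : ContDiff ℝ 1 T)
    (hc : HasCompactSupport T) : ∫ x, realDiv (fderiv ℝ T x) = 0 := by
  have hre := fun j : Fin n => integrable_and_integral_clm_fderiv hT hc
    (Complex.reCLM.comp (ContinuousLinearMap.proj (R := ℝ) (φ := fun _ : Fin n => ℂ) j))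
    (Pi.single j 1)
  have him := fun j : Fin n => integrable_and_integral_clm_fderiv hT hc
    (Complex.imCLM.comp (ContinuousLinearMap.proj (R := ℝ) (φ := fun _ : Fin n => ℂ) j))
    (Pi.single j Complex.I)
  simp only [ContinuousLinearMap.comp_apply, ContinuousLinearMap.proj_apply, Complex.reCLM_apply,
    Complex.imCLM_apply] at hre him
  unfold realDiv
  rw [integral_finsetSum (μ := volume) Finset.univ
    (f := fun j x => (fderiv ℝ T x (Pi.single j 1) j).re +
      (fderiv ℝ T x (Pi.single j Complex.I) j).im) fun j _ => (hre j).1.add (him j).1]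
  refine Finset.sum_eq_zero fun j _ => ?_
  rw [integral_add (hre j).1 (him j).1, (hre j).2, (him j).2, add_zero]

lemma sum_clm_single_eq {n : ℕ} (a : Cn n →L[ℝ] ℝ) (q : Cn n) :
    ∑ j, (a (Pi.single j 1) * (q j).re + a (Pi.single j Complex.I) * (q j).im) = a q := by
  have : q = ∑ j, ((q j).re • (Pi.single j (1 : ℂ) : Cn n) +
      (q j).im • (Pi.single j Complex.I : Cn n)) := by
    conv_lhs => rw [← Finset.univ_sum_single q]
    refine Finset.sum_congr rfl fun j _ => ?_
    rw [← Pi.single_smul, ← Pi.single_smul, ← Pi.single_add]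
    congr 1
    simp [Complex.re_add_im]
  conv_rhs => rw [this]
  rw [map_sum]
  refine Finset.sum_congr rfl fun j _ => ?_
  simp [mul_comm]

lemma single_I {n : ℕ} (j : Fin n) :
    (Pi.single j Complex.I : Cn n) = Complex.I • Pi.single j 1 := by
  rw [← Pi.single_smul]; simp

/-- If `φ` is a real function of `g` and `g` is holomorphic, then
`φ(g) · conj J · adj(Dg) v` has divergence `Dφ(g)(v) |J|²`. -/
lemma realDiv_pullback {n : ℕ} {g : Cn n → Cn n} {x : Cn n} (hg : AnalyticAt ℂ g x)
    (v : Cn n) {ρ : Cn n → ℝ} (hρ : DifferentiableAt ℝ ρ (g x)) :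
    realDiv (fderiv ℝ (fun y => ρ (g y) • ((starRingEnd ℂ) (jac g y) • adjField g v y)) x) =
      fderiv ℝ ρ (g x) v * Complex.normSq (jac g x) := by
  have h1 : HasFDerivAt (fun y => ρ (g y))
      ((fderiv ℝ ρ (g x)).comp ((fderiv ℂ g x).restrictScalars ℝ)) x :=
    hρ.hasFDerivAt.comp x (hg.differentiableAt.hasFDerivAt.restrictScalars ℝ)
  have h2 : HasFDerivAt (fun y => (starRingEnd ℂ) (jac g y))
      ((Complex.conjCLE : ℂ →L[ℝ] ℂ).comp ((fderiv ℂ (jac g) x).restrictScalars ℝ)) x :=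
    (Complex.conjCLE : ℂ →L[ℝ] ℂ).hasFDerivAt.comp x
      ((analyticAt_jac hg).differentiableAt.hasFDerivAt.restrictScalars ℝ)
  have h3 := (analyticAt_adjField v hg).differentiableAt.hasFDerivAt.restrictScalars ℝ
  have h4 := (h1.smul (h2.smul h3)).fderiv
  change realDiv (fderiv ℝ
    ((fun y => ρ (g y)) • (fun y => (starRingEnd ℂ) (jac g y)) • adjField g v) x) = _
  rw [h4]
  have hQ := sum_fderiv_adjField_eq_zero v hg
  have hA := fderiv_adjField g v x
  set P := fderiv ℂ (jac g) x
  set L := fderiv ℂ (adjField g v) x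
  set q := adjField g v x
  set c := jac g x
  set a := (fderiv ℝ ρ (g x)).comp ((fderiv ℂ g x).restrictScalars ℝ) with ha
  have e1 := sum_clm_single_eq a ((starRingEnd ℂ) c • q)
  have e2 : a ((starRingEnd ℂ) c • q) = fderiv ℝ ρ (g x) v * Complex.normSq c := by
    have : (starRingEnd ℂ) c • c • v = Complex.normSq c • v := by
      rw [smul_smul, mul_comm, Complex.mul_conj]; ext; simp
    simp [ha, hA, this, mul_comm]
  rw [← e2, ← e1]
  have e3 : (∑ j, 2 * ((starRingEnd ℂ) c * L (Pi.single j 1) j).re) = 0 := by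
    rw [← Finset.mul_sum, ← Complex.re_sum, ← Finset.mul_sum, hQ]; simp
  have e4 : (∑ j, ρ (g x) * (2 * ((starRingEnd ℂ) c * L (Pi.single j 1) j).re)) = 0 := by
    rw [← Finset.mul_sum, e3, mul_zero]
  rw [← add_zero (∑ j, _), ← e4, ← Finset.sum_add_distrib]
  unfold realDiv
  refine Finset.sum_congr rfl fun j _ => ?_
  simp [single_I]
  ring

/-- The integral over a ball of `ρ ∘ g`-weighted divergences vanishes when the support of `ρ ∘ g`
stays away from the boundary. -/
lemma setIntegral_fderiv_mul_normSq_jac_eq_zero {n : ℕ} {g : Cn n → Cn n} {r : ℝ}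
    (hg : AnalyticOnNhd ℂ g (Metric.closedBall 0 r)) (v : Cn n) {ρ : Cn n → ℝ}
    (hρ : ContDiff ℝ 1 ρ) (hsph : ∀ x ∈ Metric.sphere (0 : Cn n) r, g x ∉ tsupport ρ) :
    ∫ x in Metric.ball 0 r, fderiv ℝ ρ (g x) v * Complex.normSq (jac g x) = 0 := by
  set T₀ : Cn n → Cn n := fun y => ρ (g y) • ((starRingEnd ℂ) (jac g y) • adjField g v y) with hT₀
  set T : Cn n → Cn n := (Metric.ball 0 r).indicator T₀ with hT
  set K : Set (Cn n) := Metric.closedBall 0 r ∩ g ⁻¹' tsupport ρ with hK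
  have hKclosed : IsClosed K :=
    hg.continuousOn.preimage_isClosed_of_isClosed Metric.isClosed_closedBall (isClosed_tsupport ρ)
  have hKcomp : IsCompact K :=
    (isCompact_closedBall (0 : Cn n) r).of_isClosed_subset hKclosed inter_subset_left
  have hKball : K ⊆ Metric.ball 0 r := by
    rintro x ⟨hx, hx'⟩
    rcases (Metric.mem_closedBall.1 hx).lt_or_eq with h | h
    · exact h
    · exact absurd hx' (hsph x h)
  have hTK : ∀ x ∉ K, T x = 0 := by
    intro x hx
    by_cases hxb : x ∈ Metric.ball 0 r
    · have : g x ∉ tsupport ρ := fun h => hx ⟨Metric.ball_subset_closedBall hxb, h⟩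
      simp [hT, hT₀, image_eq_zero_of_notMem_tsupport this]
    · simp [hT, indicator_of_notMem hxb]
  have hTin : ∀ x ∈ Metric.ball (0 : Cn n) r, T =ᶠ[𝓝 x] T₀ := fun x hx =>
    Filter.eventually_of_mem (Metric.isOpen_ball.mem_nhds hx) fun y hy => indicator_of_mem hy _
  have hTout : ∀ x ∉ K, T =ᶠ[𝓝 x] fun _ => 0 := fun x hx =>
    Filter.eventually_of_mem (hKclosed.isOpen_compl.mem_nhds hx) hTK
  have hcd : ContDiff ℝ 1 T := by
    rw [contDiff_iff_contDiffAt]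
    intro x
    by_cases hx : x ∈ Metric.ball 0 r
    · refine ContDiffAt.congr_of_eventuallyEq ?_ (hTin x hx)
      have hgx := hg x (Metric.ball_subset_closedBall hx)
      have h1 := ((analyticAt_jac hgx).contDiffAt (n := 1)).restrict_scalars ℝ
      have h2 := ((analyticAt_adjField v hgx).contDiffAt (n := 1)).restrict_scalars ℝ
      have h3 := (hgx.contDiffAt (n := 1)).restrict_scalars ℝ
      have h4 := (Complex.conjCLE : ℂ →L[ℝ] ℂ).contDiff.contDiffAt.comp x h1
      exact (hρ.contDiffAt.comp x h3).smul (h4.smul h2)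
    · exact contDiffAt_const.congr_of_eventuallyEq (hTout x fun h => hx (hKball h))
  have hsupp : HasCompactSupport T := HasCompactSupport.intro hKcomp hTK
  have hzero := integral_realDiv_eq_zero hcd hsupp
  rw [← setIntegral_eq_integral_of_forall_compl_eq_zero (s := Metric.ball 0 r)] at hzero
  · rw [← hzero]
    refine setIntegral_congr_fun measurableSet_ball fun x hx => ?_
    have hgx := hg x (Metric.ball_subset_closedBall hx)
    change _ = realDiv (fderiv ℝ T x)
    rw [(hTin x hx).fderiv_eq]
    exact (realDiv_pullback hgx v (hρ.differentiable one_ne_zero _)).symm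
  · intro x hx
    rw [(hTout x fun h => hx (hKball h)).fderiv_eq]
    simp [realDiv_zero]

/-- Surjectivity of a holomorphic map onto a small ball, when the Jacobian at `0` is nonzero but
the ball need not be small relative to the inverse function theorem. -/
lemma exists_preimage_of_jac_ne_zero {n : ℕ} {g : Cn n → Cn n} {r δ : ℝ} (hr : 0 < r)
    (hg : AnalyticOnNhd ℂ g (Metric.closedBall 0 r))
    (hδ : ∀ x ∈ Metric.sphere (0 : Cn n) r, δ ≤ ‖g x‖) (hg0 : g 0 = 0) (hJ : jac g 0 ≠ 0)
    {w : Cn n} (hw : ‖w‖ < δ) : ∃ x ∈ Metric.closedBall (0 : Cn n) r, g x = w := by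
  by_contra! hne
  have hcomp : IsCompact (g '' Metric.closedBall 0 r) :=
    (isCompact_closedBall (0 : Cn n) r).image_of_continuousOn hg.continuousOn
  obtain ⟨ε₁, hε₁, hball⟩ := Metric.isOpen_iff.1 hcomp.isClosed.isOpen_compl w
    (by rintro ⟨x, hx, hxw⟩; exact hne x hx hxw)
  obtain ⟨ε, hε, hεlt⟩ : ∃ ε, 0 < ε ∧ ε < min ε₁ (δ - ‖w‖) :=
    exists_between (lt_min hε₁ (by linarith))
  have hεε₁ : ε < ε₁ := hεlt.trans_le (min_le_left _ _)
  have hεδ : ε < δ - ‖w‖ := hεlt.trans_le (min_le_right _ _)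
  let ρ : ContDiffBump (0 : Cn n) := ⟨ε / 2, ε, by linarith, by linarith⟩
  have hρ : ContDiff ℝ 1 (ρ : Cn n → ℝ) := ρ.contDiff
  have hfdc : Continuous (fderiv ℝ (ρ : Cn n → ℝ)) := hρ.continuous_fderiv one_ne_zero
  obtain ⟨C, hC⟩ := (ρ.hasCompactSupport.fderiv (𝕜 := ℝ)).exists_bound_of_continuous hfdc
  have hjc : ContinuousOn (jac g) (Metric.closedBall 0 r) := fun x hx =>
    (analyticAt_jac (hg x hx)).continuousAt.continuousWithinAt
  have hnc : ContinuousOn (fun x => Complex.normSq (jac g x)) (Metric.closedBall 0 r) :=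
    Complex.continuous_normSq.comp_continuousOn hjc
  obtain ⟨M, hM⟩ := (isCompact_closedBall (0 : Cn n) r).exists_bound_of_continuousOn hnc
  have hsub : Metric.ball (0 : Cn n) r ⊆ Metric.closedBall 0 r := Metric.ball_subset_closedBall
  set F : ℝ → Cn n → ℝ := fun s x => ρ (g x - s • w) * Complex.normSq (jac g x) with hF
  have hgs : ∀ s : ℝ, ContinuousOn (fun x => g x - s • w) (Metric.closedBall 0 r) := fun s =>
    hg.continuousOn.sub continuousOn_const
  have hFc : ∀ s, ContinuousOn (F s) (Metric.closedBall 0 r) := fun s =>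
    (ρ.continuous.comp_continuousOn (hgs s)).mul hnc
  have hFi : ∀ s, IntegrableOn (F s) (Metric.ball 0 r) := fun s =>
    ((hFc s).integrableOn_compact (isCompact_closedBall _ _)).mono_set hsub
  set F' : ℝ → Cn n → ℝ := fun s x =>
    fderiv ℝ ρ (g x - s • w) (-w) * Complex.normSq (jac g x) with hF'
  have hF'c : ∀ s, ContinuousOn (F' s) (Metric.closedBall 0 r) := fun s =>
    ((hfdc.comp_continuousOn (hgs s)).clm_apply continuousOn_const).mul hnc
  have hderiv : ∀ s ∈ Icc (0 : ℝ) 1,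
      HasDerivAt (fun s => ∫ x in Metric.ball 0 r, F s x) 0 s := by
    intro s hs
    have hval : ∫ x in Metric.ball 0 r, F' s x = 0 := by
      have h0 := setIntegral_fderiv_mul_normSq_jac_eq_zero (g := fun x => g x - s • w) (r := r)
        (fun x hx => (hg x hx).sub analyticAt_const) (-w) hρ ?_
      · rw [← h0]
        have hj : ∀ x, jac (fun x => g x - s • w) x = jac g x := fun x => by
          have : partials (fun x => g x - s • w) x = partials g x := by
            funext k
            simp only [partials]
            rw [fderiv_sub_const]
          simp only [jac, this]
        simp [hF', hj]
      · intro x hx hx'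
        rw [ρ.tsupport_eq, mem_closedBall_zero_iff] at hx'
        change ‖g x - s • w‖ ≤ ε at hx'
        have h1 := norm_sub_norm_le (g x) (s • w)
        have h2 : ‖s • w‖ ≤ ‖w‖ := by
          rw [norm_smul, Real.norm_of_nonneg hs.1]
          exact mul_le_of_le_one_left (norm_nonneg _) hs.2
        linarith [hδ x hx]
    rw [← hval]
    refine (hasDerivAt_integral_of_dominated_loc_of_deriv_le
      (μ := volume.restrict (Metric.ball (0 : Cn n) r)) (F := F) (F' := F') (x₀ := s) (s := univ)
      (bound := fun _ => C * ‖w‖ * M) Filter.univ_mem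
      (Eventually.of_forall fun s => (hFi s).aestronglyMeasurable) (hFi s)
      (((hF'c s).mono hsub).aestronglyMeasurable measurableSet_ball)
      ?_ (integrableOn_const measure_ball_lt_top.ne) ?_).2
    · refine (ae_restrict_iff' measurableSet_ball).2 (Eventually.of_forall fun x hx s _ => ?_)
      rw [hF', norm_mul]
      refine mul_le_mul ?_ (hM x (hsub hx)) (norm_nonneg _) ?_
      · refine (ContinuousLinearMap.le_opNorm _ _).trans ?_
        rw [norm_neg]
        exact mul_le_mul_of_nonneg_right (hC _) (norm_nonneg _)
      · exact mul_nonneg ((norm_nonneg _).trans (hC 0)) (norm_nonneg _)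
    · refine Eventually.of_forall fun x s _ => ?_
      have h1 : HasDerivAt (fun s : ℝ => g x - s • w) (-w) s := by
        simpa using ((hasDerivAt_id s).smul_const w).const_sub (g x)
      exact (((hρ.differentiable one_ne_zero _).hasFDerivAt).comp_hasDerivAt s h1).mul_const _
  have hconst := constant_of_has_deriv_right_zero (a := 0) (b := 1)
    (f := fun s => ∫ x in Metric.ball 0 r, F s x)
    (fun s hs => (hderiv s hs).continuousAt.continuousWithinAt)
    (fun s hs => (hderiv s ⟨hs.1, hs.2.le⟩).hasDerivWithinAt) 1 (by simp)
  have h1 : ∫ x in Metric.ball 0 r, F 1 x = 0 := by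
    refine setIntegral_eq_zero_of_forall_eq_zero fun x hx => ?_
    have : ρ (g x - (1 : ℝ) • w) = 0 := by
      refine ρ.zero_of_le_dist ?_
      change ε ≤ _
      rw [dist_zero_right, one_smul, ← dist_eq_norm]
      by_contra! h
      exact hball (Metric.mem_ball.2 (h.trans hεε₁)) ⟨x, hsub hx, rfl⟩
    change ρ (g x - (1 : ℝ) • w) * _ = 0
    rw [this, zero_mul]
  have h0 : 0 < ∫ x in Metric.ball 0 r, F 0 x := by
    rw [setIntegral_pos_iff_support_of_nonneg_ae
      (Eventually.of_forall fun x => mul_nonneg ρ.nonneg (Complex.normSq_nonneg _)) (hFi 0)]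
    have hcont : ContinuousAt (F 0) 0 :=
      (hFc 0).continuousAt (Metric.closedBall_mem_nhds _ hr)
    have hne0 : F 0 0 ≠ 0 := by
      have : ρ (0 : Cn n) = 1 :=
        ρ.one_of_mem_closedBall (Metric.mem_closedBall_self ρ.rIn_pos.le)
      simp [hF, hg0, this, hJ]
    have hmem : Function.support (F 0) ∩ Metric.ball 0 r ∈ 𝓝 (0 : Cn n) :=
      Filter.inter_mem (hcont.eventually_ne hne0) (Metric.ball_mem_nhds _ hr)
    exact Measure.measure_pos_of_mem_nhds volume hmem
  have : ∫ x in Metric.ball 0 r, F 1 x = ∫ x in Metric.ball 0 r, F 0 x := hconst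
  linarith

end

/-- A finite holomorphic map germ between spaces of the same dimension is open at `0`. -/
lemma image_mem_nhds_zero_of_finite {n : ℕ} {g : Cn n → Cn n} {U N : Set (Cn n)} (hU : IsOpen U)
    (hU0 : (0 : Cn n) ∈ U) (hg : AnalyticOnNhd ℂ g U) (hg0 : g 0 = 0)
    (hfin : U ∩ g ⁻¹' {0} = {0}) (hN : N ∈ 𝓝 (0 : Cn n)) : g '' N ∈ 𝓝 (0 : Cn n) := by
  obtain ⟨r, hr, hrsub⟩ := Metric.nhds_basis_closedBall.mem_iff.1
    (Filter.inter_mem hN (hU.mem_nhds hU0))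
  have hgr : AnalyticOnNhd ℂ g (Metric.closedBall 0 r) := fun x hx => hg x (hrsub hx).2
  obtain ⟨δ, hδ, hδle⟩ := (isCompact_sphere (0 : Cn n) r).exists_forall_le'
    (f := fun x => ‖g x‖) (a := 0)
    (hgr.continuousOn.norm.mono Metric.sphere_subset_closedBall) (by
      intro x hx
      refine norm_pos_iff.2 fun h0 => ?_
      have hx0 : x ∈ ({0} : Set (Cn n)) :=
        hfin ▸ ⟨(hrsub (Metric.sphere_subset_closedBall hx)).2, h0⟩
      rw [mem_singleton_iff.1 hx0] at hx
      simp at hx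
      exact hr.ne hx)
  refine Filter.mem_of_superset (Metric.ball_mem_nhds (0 : Cn n) (half_pos hδ)) fun w hw => ?_
  rw [mem_ball_zero_iff] at hw
  refine image_mono (hrsub.trans inter_subset_left) ?_
  by_contra hwn
  have hcomp : IsCompact (g '' Metric.closedBall 0 r) :=
    (isCompact_closedBall (0 : Cn n) r).image_of_continuousOn hgr.continuousOn
  obtain ⟨ε, hε, hball⟩ := Metric.isOpen_iff.1 hcomp.isClosed.isOpen_compl w hwn
  set τ := min (δ / 2) ε / r with hτ
  have hτpos : 0 < τ := div_pos (lt_min (half_pos hδ) hε) hr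
  obtain ⟨t, ht, hdet⟩ : ∃ t ∈ Ioo 0 τ, (Matrix.of (partials g 0) +
      Matrix.scalar (Fin n) (t : ℂ)).det ≠ 0 := by
    obtain ⟨z, ⟨t, ht, rfl⟩, hz⟩ := ((Ioo_infinite hτpos).image
      (Complex.ofReal_injective.injOn)).exists_notMem_finset
        (-Matrix.of (partials g 0)).charpoly.roots.toFinset
    refine ⟨t, ht, fun h => hz ?_⟩
    rw [Multiset.mem_toFinset, Polynomial.mem_roots (Matrix.charpoly_monic _).ne_zero,
      Polynomial.IsRoot, Matrix.eval_charpoly, sub_neg_eq_add, add_comm]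
    exact h
  have htr : t * r < min (δ / 2) ε := by
    have := (lt_div_iff₀ hr).1 ht.2
    exact this
  have hnorm : ∀ x ∈ Metric.closedBall (0 : Cn n) r, ‖(t : ℂ) • x‖ ≤ t * r := fun x hx => by
    rw [norm_smul, Complex.norm_real, Real.norm_of_nonneg ht.1.le]
    exact mul_le_mul_of_nonneg_left (mem_closedBall_zero_iff.1 hx) ht.1.le
  obtain ⟨x, hx, hxw⟩ := exists_preimage_of_jac_ne_zero (g := fun x => g x + (t : ℂ) • x)
    (δ := δ / 2) hr
    (fun x hx => (hgr x hx).fun_add (analyticAt_const.fun_smul analyticAt_id)) (fun x hx => by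
      have h1 := hnorm x (Metric.sphere_subset_closedBall hx)
      have h2 := norm_sub_norm_le (g x) (-((t : ℂ) • x))
      rw [norm_neg, sub_neg_eq_add] at h2
      have h3 : t * r < δ / 2 := htr.trans_le (min_le_left _ _)
      have h4 := hδle x hx
      linarith) (by simp [hg0]) (by
      have : jac (fun x => g x + (t : ℂ) • x) 0 =
          (Matrix.of (partials g 0) + Matrix.scalar (Fin n) (t : ℂ)).det := by
        rw [jac, detRowCM_apply]
        congr 1
        ext k i
        have h1 := ((hg 0 hU0).differentiableAt.hasFDerivAt.add
          ((hasFDerivAt_id (𝕜 := ℂ) (0 : Cn n)).const_smul (t : ℂ))).fderiv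
        change fderiv ℂ (fun x => g x + (t : ℂ) • x) 0 = _ at h1
        change fderiv ℂ (fun x => g x + (t : ℂ) • x) 0 (Pi.single k 1) i = _
        rw [h1]
        simp [partials, Matrix.diagonal_apply, Pi.single_apply, eq_comm]
      rw [this]
      exact hdet) hw
  refine hball (Metric.mem_ball.2 ?_) ⟨x, hx, rfl⟩
  rw [dist_eq_norm, ← hxw, sub_add_cancel_left, norm_neg]
  exact (hnorm x hx).trans_lt (htr.trans_le (min_le_right _ _))

/-- A reducible germ of a hypersurface is singular: a smooth hypersurface germ is parametrized by
a ball in a hyperplane, on which the product of two nonzero holomorphic functions is nonzero. -/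
lemma not_smoothPointAt_of_germReducibleAt {n : ℕ} {Y : Set (Cn n)} {p : Cn n}
    (h : GermReducibleAt Y p) : ¬ SmoothPointAt Y p := by
  rintro ⟨V₀, φ, hV₀, hpV₀, hφ, hdφ, hYφ⟩
  obtain ⟨V, Y₁, Y₂, hV, hpV, ⟨-, h₁⟩, ⟨-, h₂⟩, hp₁, hp₂, hY, hn₁, hn₂⟩ := h
  obtain ⟨V₁, hV₁, -, hpV₁, -, ψ₁, hψ₁, -, hY₁⟩ := h₁ p hpV
  obtain ⟨V₂, hV₂, -, hpV₂, -, ψ₂, hψ₂, -, hY₂⟩ := h₂ p hpV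
  set L := fderiv ℂ φ p with hL
  obtain ⟨u, hu⟩ : ∃ u, L u = 1 := by
    obtain ⟨v, hv⟩ := DFunLike.ne_iff.1 hdφ
    exact ⟨(L v)⁻¹ • v, by rw [map_smul, smul_eq_mul]; exact inv_mul_cancel₀ hv⟩
  have hφp : φ p = 0 := by
    have : p ∈ Y ∩ V₀ := ⟨(hY.symm ▸ (Or.inl hp₁ : p ∈ Y₁ ∪ Y₂) : p ∈ Y ∩ V).1, hpV₀⟩
    rw [hYφ] at this
    exact this.2
  set Φ : Cn n → Cn n := fun x => (x - p) + (φ x - L (x - p)) • u with hΦ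
  have hΦp : Φ p = 0 := by simp [hΦ, hφp]
  have hLΦ : ∀ x, L (Φ x) = φ x := fun x => by simp [hΦ, hu]
  have hΦan : AnalyticAt ℂ Φ p :=
    (analyticAt_id.sub analyticAt_const).add
      (((hφ p hpV₀).sub ((L.analyticAt _).comp (analyticAt_id.sub analyticAt_const))).smul
        analyticAt_const)
  have hΦd : HasFDerivAt Φ ((ContinuousLinearEquiv.refl ℂ (Cn n) : Cn n →L[ℂ] Cn n)) p := by
    have h1 : HasFDerivAt (fun x : Cn n => x - p) (ContinuousLinearMap.id ℂ (Cn n)) p :=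
      (hasFDerivAt_id p).sub_const p
    have h2 := h1.add (((hφ p hpV₀).differentiableAt.hasFDerivAt.sub
      (L.hasFDerivAt.comp p h1)).smul_const u)
    refine h2.congr_fderiv ?_
    ext1 v
    simp [hL]
  have hcd : ContDiffAt ℂ ⊤ Φ p := hΦan.contDiffAt
  have hst := hcd.hasStrictFDerivAt' hΦd (by simp)
  set Ψ := hcd.localInverse hΦd (by simp) with hΨ
  have hΨan : AnalyticAt ℂ Ψ 0 := by
    have := (hcd.to_localInverse hΦd (by simp)).analyticAt
    rwa [hΦp] at this
  have hΨ0 : Ψ 0 = p := by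
    have := hcd.localInverse_apply_image hΦd (by simp)
    rwa [hΦp] at this
  have hleft : ∀ᶠ x in 𝓝 p, Ψ (Φ x) = x := hst.eventually_left_inverse
  have hright : ∀ᶠ y in 𝓝 0, Φ (Ψ y) = y := hΦp ▸ hst.eventually_right_inverse
  have hΨmem : ∀ S : Set (Cn n), IsOpen S → p ∈ S → ∀ᶠ y in 𝓝 0, Ψ y ∈ S := fun S hS hpS =>
    hΨan.continuousAt.eventually (by rw [hΨ0]; exact hS.mem_nhds hpS)
  obtain ⟨ε, hε, hball⟩ := Metric.eventually_nhds_iff_ball.1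
    (hright.and ((hΨmem _ hV hpV).and ((hΨmem _ hV₀ hpV₀).and ((hΨmem _ hV₁ hpV₁).and
      ((hΨmem _ hV₂ hpV₂).and hΨan.eventually_analyticAt)))))
  set B : Set (LinearMap.ker L.toLinearMap) := Metric.ball 0 ε with hB
  have hBE : ∀ y ∈ B, (y : Cn n) ∈ Metric.ball (0 : Cn n) ε := fun y hy => by
    rw [hB, mem_ball_zero_iff] at hy
    rwa [mem_ball_zero_iff]
  have hsubset : ∀ (X' S : Set (Cn n)) (ψ : Cn n → ℂ), IsOpen S → p ∈ S →
      X' ∩ S = {x ∈ S | ψ x = 0} → (∀ y ∈ B, ψ (Ψ y) = 0) →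
      ∃ V', IsOpen V' ∧ p ∈ V' ∧ (Y₁ ∪ Y₂) ∩ V' ⊆ X' := by
    intro X' S ψ hS hpS hX' hzero
    have hev : ∀ᶠ x in 𝓝 p, Φ x ∈ Metric.ball (0 : Cn n) ε :=
      hΦan.continuousAt.eventually (by rw [hΦp]; exact Metric.ball_mem_nhds _ hε)
    obtain ⟨V', hV', hVo, hpV'⟩ := eventually_nhds_iff.1
      (hleft.and (hev.and ((hS.eventually_mem hpS).and (hV₀.eventually_mem hpV₀))))
    refine ⟨V', hVo, hpV', fun x ⟨hxY, hxV'⟩ => ?_⟩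
    obtain ⟨hx1, hx2, hx3, hx4⟩ := hV' x hxV'
    have hφx : φ x = 0 := by
      have : x ∈ Y ∩ V₀ := ⟨(hY.symm ▸ hxY : x ∈ Y ∩ V).1, hx4⟩
      rw [hYφ] at this
      exact this.2
    have hz := hzero ⟨Φ x, by simpa [hLΦ] using hφx⟩ (by
      rw [hB, mem_ball_zero_iff]
      exact mem_ball_zero_iff.1 hx2)
    have : x ∈ X' ∩ S := by
      rw [hX']
      refine ⟨hx3, ?_⟩
      rwa [hx1] at hz
    exact this.1
  have han : ∀ (ψ : Cn n → ℂ) (S : Set (Cn n)), AnalyticOnNhd ℂ ψ S →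
      (∀ y ∈ B, Ψ y ∈ S) → AnalyticOnNhd ℂ (fun y : LinearMap.ker L.toLinearMap => ψ (Ψ y)) B := by
    intro ψ S hψ hS y hy
    have h1 : AnalyticAt ℂ (fun y : LinearMap.ker L.toLinearMap => (y : Cn n)) y :=
      (Submodule.subtypeL _).analyticAt y
    have h2 : AnalyticAt ℂ Ψ (y : Cn n) := (hball y (hBE y hy)).2.2.2.2.2
    exact AnalyticAt.fun_comp (hψ _ (hS y hy)) (h2.fun_comp h1)
  have han₁ := han ψ₁ V₁ hψ₁ fun y hy => (hball y (hBE y hy)).2.2.2.1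
  have han₂ := han ψ₂ V₂ hψ₂ fun y hy => (hball y (hBE y hy)).2.2.2.2.1
  have hprod : ∀ y ∈ B, ψ₁ (Ψ y) = 0 ∨ ψ₂ (Ψ y) = 0 := by
    intro y hy
    obtain ⟨hr, hyV, hyV₀, hyV₁, hyV₂, -⟩ := hball y (hBE y hy)
    have hφy : φ (Ψ y) = 0 := by
      rw [← hLΦ, hr]
      exact y.2
    have hmem : Ψ y ∈ Y ∩ V₀ := by
      rw [hYφ]
      exact ⟨hyV₀, hφy⟩
    have hmem' : Ψ y ∈ Y₁ ∪ Y₂ := hY ▸ ⟨hmem.1, hyV⟩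
    rcases hmem' with h | h
    · have : Ψ y ∈ Y₁ ∩ V₁ := ⟨h, hyV₁⟩
      rw [hY₁] at this
      exact Or.inl this.2
    · have : Ψ y ∈ Y₂ ∩ V₂ := ⟨h, hyV₂⟩
      rw [hY₂] at this
      exact Or.inr this.2
  have hBpre : IsPreconnected B := (convex_ball _ _).isPreconnected
  have hdich : (∀ y ∈ B, ψ₁ (Ψ y) = 0) ∨ ∀ y ∈ B, ψ₂ (Ψ y) = 0 := by
    by_cases hz : ∀ y ∈ B, ψ₁ (Ψ y) = 0
    · exact Or.inl hz
    · push Not at hz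
      obtain ⟨y₀, hy₀, hne⟩ := hz
      refine Or.inr fun y hy => han₂.eqOn_zero_of_preconnected_of_eventuallyEq_zero hBpre hy₀ ?_ hy
      filter_upwards [(han₁ y₀ hy₀).continuousAt.eventually_ne hne,
        Metric.isOpen_ball.mem_nhds hy₀] with y h1 h2
      exact (hprod y h2).resolve_left h1
  rcases hdich with hz | hz
  · obtain ⟨V', hV', hpV', hsub⟩ := hsubset Y₁ V₁ ψ₁ hV₁ hpV₁ hY₁ hz
    exact hn₂ ⟨V', hV', hpV', fun x hx => hsub ⟨Or.inr hx.1, hx.2⟩⟩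
  · obtain ⟨V', hV', hpV', hsub⟩ := hsubset Y₂ V₂ ψ₂ hV₂ hpV₂ hY₂ hz
    exact hn₁ ⟨V', hV', hpV', fun x hx => hsub ⟨Or.inl hx.1, hx.2⟩⟩

lemma isHypersurfaceIn_inter_preimage {n : ℕ} {g : Cn n → Cn n} {B V X : Set (Cn n)}
    {ψ : Cn n → ℂ} (hB : IsOpen B) (hBc : IsPreconnected B) (hg : AnalyticOnNhd ℂ g B)
    (hV : IsPreconnected V) (hgV : MapsTo g B V) (hψ : AnalyticOnNhd ℂ ψ V)
    (hne : ∃ x ∈ V, ψ x ≠ 0) (hX : X ∩ V = {x ∈ V | ψ x = 0}) {q : Cn n}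
    (himg : g '' B ∈ 𝓝 q) (hq : q ∈ V) : IsHypersurfaceIn B (B ∩ g ⁻¹' X) := by
  refine ⟨inter_subset_left, fun p hp => ⟨B, hB, hBc, hp, Subset.rfl, fun x => ψ (g x),
    fun x hx => AnalyticAt.fun_comp (hψ _ (hgV hx)) (hg x hx), ?_, ?_⟩⟩
  · by_contra! hzero
    obtain ⟨x, hx, hxne⟩ := hne
    refine hxne (hψ.eqOn_zero_of_preconnected_of_eventuallyEq_zero hV hq ?_ hx)
    filter_upwards [himg]
    rintro _ ⟨y, hy, rfl⟩
    exact hzero y hy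
  · ext x
    have := Set.ext_iff.1 hX (g x)
    simp only [mem_inter_iff, mem_ofPred_eq, mem_preimage] at this ⊢
    constructor
    · rintro ⟨⟨hx, h⟩, -⟩
      exact ⟨hx, (this.1 ⟨h, hgV hx⟩).2⟩
    · rintro ⟨hx, h⟩
      exact ⟨⟨hx, (this.2 ⟨hgV hx, h⟩).1⟩, hx⟩

/-- Irredundancy of two germs at `g p` lifts to their preimages under a map open at `p`. -/
lemma not_exists_inter_preimage_subset {n : ℕ} {g : Cn n → Cn n} {B X₁ X₂ : Set (Cn n)}
    {p q : Cn n} (hB : IsOpen B) (hp : p ∈ B) (hopen : ∀ N ∈ 𝓝 p, g '' N ∈ 𝓝 q)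
    (h : ¬ ∃ V', IsOpen V' ∧ q ∈ V' ∧ X₁ ∩ V' ⊆ X₂) :
    ¬ ∃ V', IsOpen V' ∧ p ∈ V' ∧ (B ∩ g ⁻¹' X₁) ∩ V' ⊆ B ∩ g ⁻¹' X₂ := by
  rintro ⟨V', hV', hpV', hsub⟩
  obtain ⟨O, hO, hOo, hqO⟩ := mem_nhds_iff.1
    (hopen _ ((hB.inter hV').mem_nhds ⟨hp, hpV'⟩))
  refine h ⟨O, hOo, hqO, ?_⟩
  rintro y ⟨hy, hyO⟩
  obtain ⟨x, ⟨hxB, hxV'⟩, rfl⟩ := hO hyO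
  exact (hsub ⟨⟨hxB, hy⟩, hxV'⟩).2

/-- Let `g : (ℂⁿ, 0) → (ℂⁿ, 0)` be (a representative of) a germ of a finite holomorphic
map and let `X` be a germ of an analytic hypersurface at `0` that is reducible at `0`.
Then `g⁻¹(X)` is a germ of a reducible hypersurface at `0`; in particular, `g⁻¹(X)` is
singular at `0`. -/
theorem preimage_reducible_hypersurface_reducible
    {n : ℕ} (g : Cn n → Cn n) (U W : Set (Cn n))
    (hUopen : IsOpen U) (hU0 : (0 : Cn n) ∈ U)
    (hWopen : IsOpen W) (hW0 : (0 : Cn n) ∈ W)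
    (hghol : AnalyticOnNhd ℂ g U) (hmaps : MapsTo g U W) (hg0 : g 0 = 0)
    (hfin : U ∩ g ⁻¹' {0} = {0})
    (X : Set (Cn n)) (hX : IsHypersurfaceIn W X) (hX0 : (0 : Cn n) ∈ X)
    (hXred : GermReducibleAt X 0) :
    GermReducibleAt (U ∩ g ⁻¹' X) 0 ∧ ¬ SmoothPointAt (U ∩ g ⁻¹' X) 0 := by
  have hred : GermReducibleAt (U ∩ g ⁻¹' X) 0 := by
    obtain ⟨V, X₁, X₂, hV, h0V, ⟨-, h₁⟩, ⟨-, h₂⟩, h0₁, h0₂, hXV, hn₁, hn₂⟩ := hXred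
    obtain ⟨V₁, hV₁, hV₁c, h0V₁, -, ψ₁, hψ₁, hne₁, hX₁⟩ := h₁ 0 h0V
    obtain ⟨V₂, hV₂, hV₂c, h0V₂, -, ψ₂, hψ₂, hne₂, hX₂⟩ := h₂ 0 h0V
    have hgc : Tendsto g (𝓝 0) (𝓝 0) := by
      simpa only [ContinuousAt, hg0] using (hghol 0 hU0).continuousAt
    obtain ⟨r, hr, hball⟩ := Metric.eventually_nhds_iff_ball.1
      ((hUopen.eventually_mem hU0).and ((hgc.eventually (hV.eventually_mem h0V)).and
        ((hgc.eventually (hV₁.eventually_mem h0V₁)).and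
          (hgc.eventually (hV₂.eventually_mem h0V₂)))))
    have himg : ∀ N ∈ 𝓝 (0 : Cn n), g '' N ∈ 𝓝 (0 : Cn n) := fun N hN =>
      image_mem_nhds_zero_of_finite hUopen hU0 hghol hg0 hfin hN
    have hB0 : (0 : Cn n) ∈ Metric.ball (0 : Cn n) r := Metric.mem_ball_self hr
    have hBc : IsPreconnected (Metric.ball (0 : Cn n) r) := (convex_ball _ _).isPreconnected
    have hgB : AnalyticOnNhd ℂ g (Metric.ball 0 r) := fun x hx => hghol x (hball x hx).1
    have himgB := himg _ (Metric.ball_mem_nhds 0 hr)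
    refine ⟨Metric.ball 0 r, Metric.ball 0 r ∩ g ⁻¹' X₁, Metric.ball 0 r ∩ g ⁻¹' X₂,
      Metric.isOpen_ball, hB0,
      isHypersurfaceIn_inter_preimage Metric.isOpen_ball hBc hgB hV₁c
        (fun x hx => (hball x hx).2.2.1) hψ₁ hne₁ hX₁ himgB h0V₁,
      isHypersurfaceIn_inter_preimage Metric.isOpen_ball hBc hgB hV₂c
        (fun x hx => (hball x hx).2.2.2) hψ₂ hne₂ hX₂ himgB h0V₂,
      ⟨hB0, by rwa [mem_preimage, hg0]⟩, ⟨hB0, by rwa [mem_preimage, hg0]⟩, ?_,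
      not_exists_inter_preimage_subset Metric.isOpen_ball hB0 himg hn₁,
      not_exists_inter_preimage_subset Metric.isOpen_ball hB0 himg hn₂⟩
    rw [← inter_union_distrib_left, ← preimage_union, ← hXV]
    ext x
    constructor
    · rintro ⟨⟨-, hx⟩, hxB⟩
      exact ⟨hxB, hx, (hball x hxB).2.1⟩
    · rintro ⟨hxB, hx, -⟩
      exact ⟨⟨(hball x hxB).1, hx⟩, hxB⟩
  exact ⟨hred, not_smoothPointAt_of_germReducibleAt hred⟩
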